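/- Let q(x) = 1 + 4x − x³ (so that q′(x) = 4 − 3x² and q‴(x) = −6) and let u be a classical solution of the transformed problem. Then for every t ∈ (0,T): (d/dt) ∫₀¹ q(x)·|u(x,t)|² dx + 6χ·𝔅(t)·∫₀¹ |u(x,t)|² dx + 3χ·𝔅(t)·∫₀¹ q′(x)·|u_x(x,t)|² dx = 2γ·ℭ(t)·Im ∫₀¹ q′(x)·conj(u(x,t))·u_x(x,t) dx − 2·Im ∫₀¹ I(x,t)·q(x)·conj(u(x,t))·u_x(x,t) dx. -/

import Mathlib

/- Coefficients of the transformed equation on the cylinder (0,1) × (0,T):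
   p(t) = 1/(β(t) − α(t)), 𝔅(t) = p(t)³, ℭ(t) = p(t)²,
   I(x,t) = i·(−α′(t)·p(t) + x·(d/dt) log p(t)). -/
noncomputable def pcoef (α β : ℝ → ℝ) (t : ℝ) : ℝ := (β t - α t)⁻¹
noncomputable def Bcoef (α β : ℝ → ℝ) (t : ℝ) : ℝ := (pcoef α β t) ^ 3
noncomputable def Ccoef (α β : ℝ → ℝ) (t : ℝ) : ℝ := (pcoef α β t) ^ 2
noncomputable def Icoef (α β : ℝ → ℝ) (x t : ℝ) : ℂ :=
  Complex.I * ((-(deriv α t) * pcoef α β t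
      + x * deriv (fun s => Real.log (pcoef α β s)) t : ℝ) : ℂ)

/- Moving boundary context: T > 0, α, β are C² and
   0 < α₀ ≤ β(t) − α(t) ≤ β₀ < ∞ on [0,T]. -/
def MovingBoundary (T α₀ β₀ : ℝ) (α β : ℝ → ℝ) : Prop :=
  0 < T ∧ 0 < α₀ ∧ ContDiff ℝ 2 α ∧ ContDiff ℝ 2 β ∧
    ∀ t ∈ Set.Icc (0:ℝ) T, α₀ ≤ β t - α t ∧ β t - α t ≤ β₀

/- A classical solution of the transformed problem: u, uₓ, uₓₓ, uₓₓₓ, u_t are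
   continuous on [0,1] × [0,T] (ux, uxx, uxxx the successive x-derivatives and ut the
   t-derivative of u), u satisfies
   i·u_t + i·χ·𝔅(t)·u_xxx + γ·ℭ(t)·u_xx + I(x,t)·u_x − |u|²·u = 0 on (0,1) × (0,T),
   and u = u_x = u_xx = u_xxx = 0 at x = 0 and x = 1 for all t ∈ [0,T]. -/
def IsTransfSol (T γ χ : ℝ) (α β : ℝ → ℝ)
    (u ux uxx uxxx ut : ℝ → ℝ → ℂ) : Prop :=
  (∀ t ∈ Set.Icc (0:ℝ) T, ∀ x ∈ Set.Icc (0:ℝ) 1,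
      HasDerivWithinAt (fun y => u y t) (ux x t) (Set.Icc 0 1) x) ∧
  (∀ t ∈ Set.Icc (0:ℝ) T, ∀ x ∈ Set.Icc (0:ℝ) 1,
      HasDerivWithinAt (fun y => ux y t) (uxx x t) (Set.Icc 0 1) x) ∧
  (∀ t ∈ Set.Icc (0:ℝ) T, ∀ x ∈ Set.Icc (0:ℝ) 1,
      HasDerivWithinAt (fun y => uxx y t) (uxxx x t) (Set.Icc 0 1) x) ∧
  (∀ x ∈ Set.Icc (0:ℝ) 1, ∀ t ∈ Set.Icc (0:ℝ) T,
      HasDerivWithinAt (fun s => u x s) (ut x t) (Set.Icc 0 T) t) ∧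
  ContinuousOn (fun q : ℝ × ℝ => u q.1 q.2) (Set.Icc 0 1 ×ˢ Set.Icc 0 T) ∧
  ContinuousOn (fun q : ℝ × ℝ => ux q.1 q.2) (Set.Icc 0 1 ×ˢ Set.Icc 0 T) ∧
  ContinuousOn (fun q : ℝ × ℝ => uxx q.1 q.2) (Set.Icc 0 1 ×ˢ Set.Icc 0 T) ∧
  ContinuousOn (fun q : ℝ × ℝ => uxxx q.1 q.2) (Set.Icc 0 1 ×ˢ Set.Icc 0 T) ∧
  ContinuousOn (fun q : ℝ × ℝ => ut q.1 q.2) (Set.Icc 0 1 ×ˢ Set.Icc 0 T) ∧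
  (∀ x ∈ Set.Ioo (0:ℝ) 1, ∀ t ∈ Set.Ioo (0:ℝ) T,
      Complex.I * ut x t + Complex.I * (χ : ℂ) * (Bcoef α β t : ℂ) * uxxx x t
        + (γ : ℂ) * (Ccoef α β t : ℂ) * uxx x t + Icoef α β x t * ux x t
        - (‖u x t‖ : ℂ) ^ 2 * u x t = 0) ∧
  (∀ t ∈ Set.Icc (0:ℝ) T,
      u 0 t = 0 ∧ u 1 t = 0 ∧ ux 0 t = 0 ∧ ux 1 t = 0 ∧
      uxx 0 t = 0 ∧ uxx 1 t = 0 ∧ uxxx 0 t = 0 ∧ uxxx 1 t = 0)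

theorem HasDerivAt.complex_re {f : ℝ → ℂ} {f' : ℂ} {x : ℝ} (h : HasDerivAt f f' x) :
    HasDerivAt (fun y => (f y).re) f'.re x :=
  Complex.reCLM.hasFDerivAt.comp_hasDerivAt x h

theorem HasDerivAt.complex_im {f : ℝ → ℂ} {f' : ℂ} {x : ℝ} (h : HasDerivAt f f' x) :
    HasDerivAt (fun y => (f y).im) f'.im x :=
  Complex.imCLM.hasFDerivAt.comp_hasDerivAt x h

theorem im_intervalIntegral {f : ℝ → ℂ} {a b : ℝ}
    (hf : IntervalIntegrable f MeasureTheory.volume a b) :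
    (∫ x in a..b, f x).im = ∫ x in a..b, (f x).im :=
  (Complex.imCLM.intervalIntegral_comp_comm hf).symm

/-- Differentiation under the integral sign for a weighted squared modulus on a rectangle. -/
theorem hasDerivAt_integral_weight_mul_norm_sq {T : ℝ} {q : ℝ → ℝ} {u ut : ℝ → ℝ → ℂ}
    (hq : Continuous q)
    (hd : ∀ x ∈ Set.Icc (0:ℝ) 1, ∀ t ∈ Set.Icc (0:ℝ) T,
      HasDerivWithinAt (fun s => u x s) (ut x t) (Set.Icc 0 T) t)
    (hu : ContinuousOn (fun q : ℝ × ℝ => u q.1 q.2) (Set.Icc 0 1 ×ˢ Set.Icc 0 T))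
    (hut : ContinuousOn (fun q : ℝ × ℝ => ut q.1 q.2) (Set.Icc 0 1 ×ˢ Set.Icc 0 T))
    {t : ℝ} (ht : t ∈ Set.Ioo 0 T) :
    HasDerivAt (fun s => ∫ x in (0:ℝ)..1, q x * ‖u x s‖ ^ 2)
      (∫ x in (0:ℝ)..1,
        q x * (2 * ((u x t).re * (ut x t).re + (u x t).im * (ut x t).im))) t := by
  have slice : ∀ {f : ℝ × ℝ → ℝ}, ContinuousOn f (Set.Icc 0 1 ×ˢ Set.Icc 0 T) →
      ∀ s ∈ Set.Icc 0 T, ContinuousOn (fun x => f (x, s)) (Set.Icc 0 1) := fun hf s hs =>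
    hf.comp (f := fun x => (x, s)) (by fun_prop) fun x hx => ⟨hx, hs⟩
  have hF : ContinuousOn (fun p : ℝ × ℝ => q p.1 * ‖u p.1 p.2‖ ^ 2)
      (Set.Icc 0 1 ×ˢ Set.Icc 0 T) := by fun_prop
  have hF' : ContinuousOn (fun p : ℝ × ℝ => q p.1 *
      (2 * ((u p.1 p.2).re * (ut p.1 p.2).re + (u p.1 p.2).im * (ut p.1 p.2).im)))
      (Set.Icc 0 1 ×ˢ Set.Icc 0 T) := by
    have h1 := Complex.continuous_re.comp_continuousOn hu
    have h2 := Complex.continuous_im.comp_continuousOn hu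
    have h3 := Complex.continuous_re.comp_continuousOn hut
    have h4 := Complex.continuous_im.comp_continuousOn hut
    exact (hq.comp continuous_fst).continuousOn.mul
      (continuousOn_const.mul ((h1.mul h3).add (h2.mul h4)))
  obtain ⟨M, hM⟩ := (isCompact_Icc.prod isCompact_Icc).exists_bound_of_continuousOn hF'
  have hsub : Set.uIoc (0:ℝ) 1 ⊆ Set.Icc 0 1 := by
    rw [Set.uIoc_of_le zero_le_one]; exact Set.Ioc_subset_Icc_self
  refine (intervalIntegral.hasDerivAt_integral_of_dominated_loc_of_deriv_le
    (F := fun s x => q x * ‖u x s‖ ^ 2)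
    (F' := fun s x => q x * (2 * ((u x s).re * (ut x s).re + (u x s).im * (ut x s).im)))
    (bound := fun _ => M) (Ioo_mem_nhds ht.1 ht.2) ?_ ?_ ?_ ?_ ?_ ?_).2
  · filter_upwards [Ioo_mem_nhds ht.1 ht.2] with s hs
    exact ((slice hF s (Set.Ioo_subset_Icc_self hs)).mono hsub).aestronglyMeasurable
      measurableSet_uIoc
  · exact (slice hF t (Set.Ioo_subset_Icc_self ht)).intervalIntegrable_of_Icc zero_le_one
  · exact ((slice hF' t (Set.Ioo_subset_Icc_self ht)).mono hsub).aestronglyMeasurable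
      measurableSet_uIoc
  · exact .of_forall fun x hx s hs => hM (x, s) ⟨hsub hx, Set.Ioo_subset_Icc_self hs⟩
  · exact intervalIntegrable_const
  · refine .of_forall fun x hx s hs => ?_
    have h := (hd x (hsub hx) s (Set.Ioo_subset_Icc_self hs)).hasDerivAt (Icc_mem_nhds hs.1 hs.2)
    simp only [Complex.sq_norm, Complex.normSq_apply]
    refine (((h.complex_re.mul h.complex_re).add (h.complex_im.mul h.complex_im)).const_mul
      (q x)).congr_deriv ?_
    ring

/-- the q-weighted energy identity, with q(x) = 1 + 4x − x³
(so q′(x) = 4 − 3x²), for a classical solution u of the transformed problem: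
for every t ∈ (0,T),
(d/dt)∫₀¹ q|u|²dx + 6χ𝔅(t)∫₀¹|u|²dx + 3χ𝔅(t)∫₀¹ q′|uₓ|²dx
  = 2γℭ(t)·Im∫₀¹ q′·conj(u)·uₓ dx − 2·Im∫₀¹ I(x,t)·q·conj(u)·uₓ dx. -/
theorem stmt10 (T α₀ β₀ γ χ : ℝ) (α β : ℝ → ℝ)
    (hmb : MovingBoundary T α₀ β₀ α β) (hγ : 0 < γ) (hχ : 0 < χ)
    (u ux uxx uxxx ut : ℝ → ℝ → ℂ)
    (hu : IsTransfSol T γ χ α β u ux uxx uxxx ut) :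
    ∀ t ∈ Set.Ioo (0:ℝ) T,
      HasDerivAt (fun s => ∫ x in (0:ℝ)..1, (1 + 4 * x - x ^ 3) * ‖u x s‖ ^ 2)
        (- 6 * χ * Bcoef α β t * (∫ x in (0:ℝ)..1, ‖u x t‖ ^ 2)
          - 3 * χ * Bcoef α β t * (∫ x in (0:ℝ)..1, (4 - 3 * x ^ 2) * ‖ux x t‖ ^ 2)
          + 2 * γ * Ccoef α β t * (∫ x in (0:ℝ)..1,
              ((4 - 3 * x ^ 2 : ℝ) : ℂ) * (starRingEnd ℂ (u x t) * ux x t)).im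
          - 2 * (∫ x in (0:ℝ)..1, Icoef α β x t * ((1 + 4 * x - x ^ 3 : ℝ) : ℂ)
              * (starRingEnd ℂ (u x t) * ux x t)).im) t := by
  intro t ht
  obtain ⟨hdx, hdxx, hdxxx, hdt, cu, cux, cuxx, cuxxx, cut, hpde, hbd⟩ := hu
  have htI := Set.Ioo_subset_Icc_self ht
  have slice : ∀ {f : ℝ → ℝ → ℂ},
      ContinuousOn (fun p : ℝ × ℝ => f p.1 p.2) (Set.Icc 0 1 ×ˢ Set.Icc 0 T) →
      ContinuousOn (fun x => f x t) (Set.Icc 0 1) := fun hf =>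
    hf.comp (f := fun x => (x, t)) (by fun_prop) fun x hx => ⟨hx, htI⟩
  have re_cont : ∀ {f : ℝ → ℂ}, ContinuousOn f (Set.Icc 0 1) →
      ContinuousOn (fun x => (f x).re) (Set.Icc 0 1) := fun hf =>
    Complex.continuous_re.comp_continuousOn hf
  have im_cont : ∀ {f : ℝ → ℂ}, ContinuousOn f (Set.Icc 0 1) →
      ContinuousOn (fun x => (f x).im) (Set.Icc 0 1) := fun hf =>
    Complex.continuous_im.comp_continuousOn hf
  have su := slice cu
  have sux := slice cux
  have ru := re_cont su
  have iu := im_cont su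
  have rux := re_cont sux
  have iux := im_cont sux
  have ruxx := re_cont (slice cuxx)
  have iuxx := im_cont (slice cuxx)
  have rut := re_cont (slice cut)
  have iut := im_cont (slice cut)
  obtain ⟨c₀, c₁, hI⟩ : ∃ c₀ c₁ : ℝ, ∀ x, Icoef α β x t = Complex.I * ((c₀ + x * c₁ : ℝ) : ℂ) :=
    ⟨_, _, fun _ => rfl⟩
  replace hpde := fun x hx => hpde x hx t ht
  simp only [hI] at hpde ⊢
  generalize Bcoef α β t = B at hpde ⊢
  generalize Ccoef α β t = C at hpde ⊢
  have sconj : ContinuousOn (fun x => starRingEnd ℂ (u x t)) (Set.Icc 0 1) :=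
    Complex.continuous_conj.comp_continuousOn su
  have hmain := hasDerivAt_integral_weight_mul_norm_sq
    (q := fun x => 1 + 4 * x - x ^ 3) (by fun_prop) hdt cu cut ht
  refine hmain.congr_deriv ?_
  rw [im_intervalIntegral (ContinuousOn.intervalIntegrable_of_Icc zero_le_one
      (by fun_prop)),
    im_intervalIntegral (ContinuousOn.intervalIntegrable_of_Icc zero_le_one
      (by fun_prop))]
  have hA : IntervalIntegrable (fun x => (1 + 4 * x - x ^ 3) *
      (2 * ((u x t).re * (ut x t).re + (u x t).im * (ut x t).im))) MeasureTheory.volume 0 1 :=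
    ContinuousOn.intervalIntegrable_of_Icc zero_le_one (by fun_prop)
  have hW : IntervalIntegrable (fun x => ‖u x t‖ ^ 2) MeasureTheory.volume 0 1 :=
    ContinuousOn.intervalIntegrable_of_Icc zero_le_one (by fun_prop)
  have hV : IntervalIntegrable (fun x => (4 - 3 * x ^ 2) * ‖ux x t‖ ^ 2)
      MeasureTheory.volume 0 1 :=
    ContinuousOn.intervalIntegrable_of_Icc zero_le_one (by fun_prop)
  have hP : IntervalIntegrable (fun x => (((4 - 3 * x ^ 2 : ℝ) : ℂ) *
      (starRingEnd ℂ (u x t) * ux x t)).im) MeasureTheory.volume 0 1 :=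
    ContinuousOn.intervalIntegrable_of_Icc zero_le_one (im_cont (by fun_prop))
  have hQ : IntervalIntegrable (fun x => (Complex.I * ((c₀ + x * c₁ : ℝ) : ℂ) *
      ((1 + 4 * x - x ^ 3 : ℝ) : ℂ) * (starRingEnd ℂ (u x t) * ux x t)).im)
      MeasureTheory.volume 0 1 :=
    ContinuousOn.intervalIntegrable_of_Icc zero_le_one (im_cont (by fun_prop))
  have hS := (((hA.add (hW.const_mul (6 * χ * B))).add (hV.const_mul (3 * χ * B))).sub
    (hP.const_mul (2 * γ * C))).add (hQ.const_mul 2)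
  let G : ℝ → ℝ := fun x =>
    -(χ * B) * ((1 + 4 * x - x ^ 3) * (2 * ((u x t).re * (uxx x t).re + (u x t).im * (uxx x t).im)
        - ((ux x t).re * (ux x t).re + (ux x t).im * (ux x t).im))
      - (4 - 3 * x ^ 2) * (2 * ((u x t).re * (ux x t).re + (u x t).im * (ux x t).im))
      - 6 * x * ((u x t).re * (u x t).re + (u x t).im * (u x t).im))
    - 2 * γ * C * ((1 + 4 * x - x ^ 3) * ((u x t).re * (ux x t).im - (u x t).im * (ux x t).re))
  have hG : ContinuousOn G (Set.Icc 0 1) := by fun_prop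
  have hFTC := intervalIntegral.integral_eq_sub_of_hasDerivAt_of_le zero_le_one hG
    (fun x hx => ?_) hS
  · obtain ⟨h0, h1, h2, h3, -⟩ := hbd t htI
    have hG0 : G 0 = 0 := by simp [G, h0, h2]
    have hG1 : G 1 = 0 := by simp [G, h1, h3]
    rw [hG0, hG1, intervalIntegral.integral_add (((hA.add (hW.const_mul (6 * χ * B))).add
        (hV.const_mul (3 * χ * B))).sub (hP.const_mul (2 * γ * C))) (hQ.const_mul 2),
      intervalIntegral.integral_sub ((hA.add (hW.const_mul (6 * χ * B))).add
        (hV.const_mul (3 * χ * B))) (hP.const_mul (2 * γ * C)),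
      intervalIntegral.integral_add (hA.add (hW.const_mul (6 * χ * B)))
        (hV.const_mul (3 * χ * B)),
      intervalIntegral.integral_add hA (hW.const_mul (6 * χ * B))] at hFTC
    simp only [intervalIntegral.integral_const_mul] at hFTC
    linarith
  · have hxI := Set.Ioo_subset_Icc_self hx
    have hn := Icc_mem_nhds hx.1 hx.2
    have d1 := (hdx t htI x hxI).hasDerivAt hn
    have d2 := (hdxx t htI x hxI).hasDerivAt hn
    have d3 := (hdxxx t htI x hxI).hasDerivAt hn
    have r1 := d1.complex_re
    have i1 := d1.complex_im
    have r2 := d2.complex_re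
    have i2 := d2.complex_im
    have r3 := d3.complex_re
    have i3 := d3.complex_im
    have hq : HasDerivAt (fun y : ℝ => 1 + 4 * y - y ^ 3) (4 - 3 * x ^ 2) x :=
      ((((hasDerivAt_id' x).const_mul 4).const_add 1).sub (hasDerivAt_pow 3 x)).congr_deriv
        (by norm_num)
    have hq' : HasDerivAt (fun y : ℝ => 4 - 3 * y ^ 2) (-(6 * x)) x :=
      (((hasDerivAt_pow 2 x).const_mul 3).const_sub 4).congr_deriv (by norm_num; ring)
    have hq'' : HasDerivAt (fun y : ℝ => 6 * y) 6 x :=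
      ((hasDerivAt_id' x).const_mul 6).congr_deriv (by norm_num)
    have hD := ((((hq.mul ((((r1.mul r3).add (i1.mul i3)).const_mul 2).sub
        ((r2.mul r2).add (i2.mul i2)))).sub
      (hq'.mul (((r1.mul r2).add (i1.mul i2)).const_mul 2))).sub
      (hq''.mul ((r1.mul r1).add (i1.mul i1)))).const_mul (-(χ * B))).sub
      ((hq.mul ((r1.mul i2).sub (i1.mul r2))).const_mul (2 * γ * C))
    refine hD.congr_deriv ?_
    have hp := hpde x hx
    have hpr := congrArg Complex.re hp
    have hpi := congrArg Complex.im hp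
    rw [← Complex.ofReal_pow] at hpr hpi
    simp only [Pi.add_apply, Pi.sub_apply, Pi.mul_apply, Complex.sq_norm,
      Complex.normSq_apply, Complex.add_re, Complex.add_im,
      Complex.sub_re, Complex.sub_im, Complex.mul_re, Complex.mul_im, Complex.I_re, Complex.I_im,
      Complex.ofReal_re, Complex.ofReal_im, Complex.zero_re, Complex.zero_im, Complex.conj_re,
      Complex.conj_im] at hpr hpi ⊢
    linear_combination (1 + 4 * x - x ^ 3) * 2 * (u x t).im * hpr
      - (1 + 4 * x - x ^ 3) * 2 * (u x t).re * hpi
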